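/- Let ω = exp(2πi/3) ∈ ℂ, let ℤ[ω] ⊆ ℂ be the Eisenstein integers, let D = diag(1, ω, ω²) ∈ GL(3, ℂ), and let Γ be the subgroup of GL(3,ℂ) generated by Hei(ℤ[ω]) ∪ {D}. Then every subgroup of finite index in Γ is nonabelian; that is, Γ is not virtually abelian. -/

import Mathlib

/-- The upper unitriangular 3×3 matrix `M(x,y,z)`. -/
def heisM {R : Type*} [CommRing R] (x y z : R) : Matrix (Fin 3) (Fin 3) R :=
  !![1, x, z; 0, 1, y; 0, 0, 1]

/-- For a subring `R ⊆ ℂ`, the Heisenberg group `Hei(R)`: the subgroup of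
`GL(3,ℂ)` of upper unitriangular matrices with entries in `R`. -/
def HeiC (R : Subring ℂ) : Subgroup (GL (Fin 3) ℂ) where
  carrier := {A | ∃ x ∈ R, ∃ y ∈ R, ∃ z ∈ R,
    (A : Matrix (Fin 3) (Fin 3) ℂ) = heisM x y z}
  one_mem' := by
    refine ⟨0, zero_mem R, 0, zero_mem R, 0, zero_mem R, ?_⟩
    ext i j
    fin_cases i <;> fin_cases j <;>
      simp [heisM, Matrix.one_apply, Matrix.vecHead, Matrix.vecTail]
  mul_mem' := by
    rintro A B ⟨x, hx, y, hy, z, hz, hA⟩ ⟨x', hx', y', hy', z', hz', hB⟩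
    refine ⟨x + x', add_mem hx hx', y + y', add_mem hy hy',
      z + z' + x * y', add_mem (add_mem hz hz') (mul_mem hx hy'), ?_⟩
    rw [Units.val_mul, hA, hB]
    ext i j
    fin_cases i <;> fin_cases j <;>
      simp [heisM, Matrix.mul_apply, Fin.sum_univ_three, Matrix.vecHead, Matrix.vecTail] <;> ring
  inv_mem' := by
    rintro A ⟨x, hx, y, hy, z, hz, hA⟩
    refine ⟨-x, neg_mem hx, -y, neg_mem hy, x * y - z,
      sub_mem (mul_mem hx hy) hz, ?_⟩
    have h1 : (A : Matrix (Fin 3) (Fin 3) ℂ) * heisM (-x) (-y) (x * y - z) = 1 := by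
      rw [hA]
      ext i j
      fin_cases i <;> fin_cases j <;>
        simp [heisM, Matrix.mul_apply, Fin.sum_univ_three, Matrix.one_apply, Matrix.vecHead, Matrix.vecTail] <;> ring
    have h2 : ((A⁻¹ : GL (Fin 3) ℂ) : Matrix (Fin 3) (Fin 3) ℂ) *
        (A : Matrix (Fin 3) (Fin 3) ℂ) = 1 := by
      rw [← Units.val_mul, inv_mul_cancel, Units.val_one]
    calc ((A⁻¹ : GL (Fin 3) ℂ) : Matrix (Fin 3) (Fin 3) ℂ)
        = ((A⁻¹ : GL (Fin 3) ℂ) : Matrix (Fin 3) (Fin 3) ℂ) *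
          ((A : Matrix (Fin 3) (Fin 3) ℂ) * heisM (-x) (-y) (x * y - z)) := by
          rw [h1, mul_one]
      _ = (((A⁻¹ : GL (Fin 3) ℂ) : Matrix (Fin 3) (Fin 3) ℂ) *
          (A : Matrix (Fin 3) (Fin 3) ℂ)) * heisM (-x) (-y) (x * y - z) := by
          rw [mul_assoc]
      _ = heisM (-x) (-y) (x * y - z) := by rw [h2, one_mul]

/-- The primitive third root of unity `ω = exp(2πi/3)`. -/
noncomputable def eisenOmega : ℂ := Complex.exp (2 * Real.pi * Complex.I / 3)

/-- The Eisenstein integers: the subring of `ℂ` generated by `ω`. -/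
noncomputable def Eisenstein : Subring ℂ := Subring.closure {eisenOmega}

lemma eisenOmega_pow_three : eisenOmega ^ 3 = 1 := by
  rw [eisenOmega, ← Complex.exp_nat_mul]
  have h : (3 : ℕ) * (2 * (Real.pi : ℂ) * Complex.I / 3) =
      2 * (Real.pi : ℂ) * Complex.I := by push_cast; ring
  rw [h, Complex.exp_two_pi_mul_I]

/-- The diagonal matrix `D = diag(1, ω, ω²)` as an element of `GL(3,ℂ)`. -/
noncomputable def DU : GL (Fin 3) ℂ where
  val := Matrix.diagonal ![1, eisenOmega, eisenOmega ^ 2]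
  inv := Matrix.diagonal ![1, eisenOmega ^ 2, eisenOmega]
  val_inv := by
    rw [Matrix.diagonal_mul_diagonal]
    have h1 : eisenOmega * eisenOmega ^ 2 = 1 := by
      rw [← pow_succ']; exact eisenOmega_pow_three
    have h2 : eisenOmega ^ 2 * eisenOmega = 1 := by
      rw [← pow_succ]; exact eisenOmega_pow_three
    ext i j
    fin_cases i <;> fin_cases j <;>
      simp [Matrix.diagonal, Matrix.one_apply, h1, h2]
  inv_val := by
    rw [Matrix.diagonal_mul_diagonal]
    have h1 : eisenOmega * eisenOmega ^ 2 = 1 := by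
      rw [← pow_succ']; exact eisenOmega_pow_three
    have h2 : eisenOmega ^ 2 * eisenOmega = 1 := by
      rw [← pow_succ]; exact eisenOmega_pow_three
    ext i j
    fin_cases i <;> fin_cases j <;>
      simp [Matrix.diagonal, Matrix.one_apply, h1, h2]

/-- The group `Γ = Hei(ℤ[ω]) ⋊ C₃`: the subgroup of `GL(3,ℂ)` generated by
`Hei(ℤ[ω])` together with `D = diag(1, ω, ω²)`. -/
noncomputable def GammaGrp : Subgroup (GL (Fin 3) ℂ) :=
  Subgroup.closure ((HeiC Eisenstein : Set (GL (Fin 3) ℂ)) ∪ {DU})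

lemma heisM_mul_aux (x y z x' y' z' : ℂ) :
    heisM x y z * heisM x' y' z' = heisM (x + x') (y + y') (z + z' + x * y') := by
  ext i j
  fin_cases i <;> fin_cases j <;>
    simp [heisM, Matrix.mul_apply, Fin.sum_univ_three, Matrix.vecHead, Matrix.vecTail] <;> ring

lemma heisM_zero_aux : heisM (0 : ℂ) 0 0 = 1 := by
  ext i j
  fin_cases i <;> fin_cases j <;>
    simp [heisM, Matrix.one_apply, Matrix.vecHead, Matrix.vecTail]

/-- The elements `M(x,y,0)` with `x * y = 0`, as elements of `GL(3,ℂ)`. -/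
def heisUnitAux (x y : ℂ) (h : x * y = 0) : GL (Fin 3) ℂ where
  val := heisM x y 0
  inv := heisM (-x) (-y) 0
  val_inv := by rw [heisM_mul_aux, ← heisM_zero_aux]; simp [h]
  inv_val := by rw [heisM_mul_aux, ← heisM_zero_aux]; simp [h]

lemma heisM_pow_aux (x y : ℂ) (h : x * y = 0) (n : ℕ) :
    heisM x y 0 ^ n = heisM (n * x) (n * y) 0 := by
  induction n with
  | zero => simp [heisM_zero_aux]
  | succ k ih =>
    have h' : (k : ℂ) * x * y = 0 := by rw [mul_assoc, h, mul_zero]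
    rw [pow_succ, ih, heisM_mul_aux, h']
    push_cast
    congr 1 <;> ring

lemma heisUnitAux_mem (x y : ℂ) (h : x * y = 0) (hx : x ∈ Eisenstein) (hy : y ∈ Eisenstein) :
    heisUnitAux x y h ∈ GammaGrp :=
  Subgroup.subset_closure (Or.inl ⟨x, hx, y, hy, 0, zero_mem _, rfl⟩)

/-- Every finite-index subgroup of `Γ = Hei(ℤ[ω]) ⋊ C₃` is nonabelian;
that is, `Γ` is not virtually abelian. -/
theorem gamma_not_virtually_abelian :
    ∀ H : Subgroup GammaGrp, H.index ≠ 0 → ¬ IsMulCommutative H := by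
  intro H hH hc
  let A : GammaGrp := ⟨heisUnitAux 1 0 (by simp),
    heisUnitAux_mem _ _ _ (one_mem _) (zero_mem _)⟩
  let B : GammaGrp := ⟨heisUnitAux 0 1 (by simp),
    heisUnitAux_mem _ _ _ (zero_mem _) (one_mem _)⟩
  obtain ⟨m, hm, -, hA⟩ := Subgroup.exists_pow_mem_of_index_ne_zero hH A
  obtain ⟨n, hn, -, hB⟩ := Subgroup.exists_pow_mem_of_index_ne_zero hH B
  have hcomm : A ^ m * B ^ n = B ^ n * A ^ m :=
    congrArg Subtype.val (hc.is_comm.comm (⟨A ^ m, hA⟩ : H) ⟨B ^ n, hB⟩)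
  have h1 : heisM (1 : ℂ) 0 0 ^ m * heisM (0 : ℂ) 1 0 ^ n
      = heisM (0 : ℂ) 1 0 ^ n * heisM (1 : ℂ) 0 0 ^ m :=
    congrArg (fun g : GammaGrp => ((g : GL (Fin 3) ℂ) : Matrix (Fin 3) (Fin 3) ℂ)) hcomm
  rw [heisM_pow_aux _ _ (by simp), heisM_pow_aux _ _ (by simp), heisM_mul_aux,
    heisM_mul_aux] at h1
  have h2 := congrFun (congrFun h1 0) 2
  simp [heisM] at h2
  omega
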